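/- arXiv:1108.5554 — 2 statements merged into one kernel-verified Lean document; each statement's English description precedes it below -/
import Mathlib

section
/- There exists an absolute constant C > 0 such that for all 0 < r < R, all μ > 0 and all φ ∈ [0, π/2], ∫_{B_{r/2,2R} ∩ {ξ₁ ξ₂ ≥ 0}} (1 + μ ξ₂² (ξ₁ cos φ + ξ₂ sin φ)² / (8 R³))^{−1} dξ ≤ C · min{ R², max{ R^{5/2} r^{−1} μ^{−1/2}, R^{7/4} μ^{−1/4} } }, where B_{r/2,2R} = {ξ ∈ ℝ² : |ξ₁| ≥ r/2 and |ξ| ≤ 2R}. -/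
open MeasureTheory Real
open scoped ENNReal

noncomputable section

abbrev E2 := EuclideanSpace ℝ (Fin 2)

/-- The coordinate identification of the Euclidean plane with `ℝ × ℝ` preserves volume. -/
theorem volume_preserving_coordinates :
    MeasurePreserving (fun ξ : E2 => (ξ 0, ξ 1)) volume (volume : Measure (ℝ × ℝ)) :=
  (volume_preserving_finTwoArrow ℝ).comp (PiLp.volume_preserving_ofLp (Fin 2))

theorem measurableEmbedding_coordinates :
    MeasurableEmbedding (fun ξ : E2 => (ξ 0, ξ 1)) :=
  (MeasurableEquiv.finTwoArrow (α := ℝ)).measurableEmbedding.comp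
    (MeasurableEquiv.toLp 2 (Fin 2 → ℝ)).symm.measurableEmbedding

/-- A nonnegative function on a measurable subset of the plane which is dominated by a product
`u (ξ 0) * v (ξ 1)` has integral at most `(∫ u) * (∫ v)`. -/
theorem setIntegral_le_integral_mul_integral {S : Set E2} (hS : MeasurableSet S)
    {f : E2 → ℝ} {u v : ℝ → ℝ} (hf : ∀ ξ, 0 ≤ f ξ) (hu : ∀ x, 0 ≤ u x) (hv : ∀ y, 0 ≤ v y)
    (hui : Integrable u) (hvi : Integrable v) (hfuv : ∀ ξ ∈ S, f ξ ≤ u (ξ 0) * v (ξ 1)) :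
    ∫ ξ in S, f ξ ≤ (∫ x, u x) * ∫ y, v y := by
  have hint : Integrable (fun ξ : E2 => u (ξ 0) * v (ξ 1)) :=
    volume_preserving_coordinates.integrable_comp_of_integrable (hui.mul_prod hvi)
  have heq : ∫ ξ : E2, u (ξ 0) * v (ξ 1) = (∫ x, u x) * ∫ y, v y := by
    rw [← integral_prod_mul]
    exact volume_preserving_coordinates.integral_comp measurableEmbedding_coordinates
      (fun z : ℝ × ℝ => u z.1 * v z.2)
  rw [← heq, ← integral_indicator hS]
  refine integral_mono_of_nonneg (.of_forall fun ξ => Set.indicator_nonneg (fun ξ _ => hf ξ) ξ)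
    hint (.of_forall fun ξ => ?_)
  exact Set.indicator_apply_le' (hfuv ξ) fun _ => mul_nonneg (hu _) (hv _)

theorem integrable_inv_one_add_mul_sq {c : ℝ} (hc : 0 < c) :
    Integrable (fun y : ℝ => (1 + (c * y) ^ 2)⁻¹) :=
  integrable_inv_one_add_sq.comp_mul_left' hc.ne'

theorem integral_inv_one_add_mul_sq {c : ℝ} (hc : 0 < c) :
    ∫ y : ℝ, (1 + (c * y) ^ 2)⁻¹ = π / c := by
  rw [Measure.integral_comp_mul_left (fun y : ℝ => (1 + y ^ 2)⁻¹) c,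
    integral_univ_inv_one_add_sq, abs_of_pos (inv_pos.2 hc), smul_eq_mul]
  field_simp

/-- In the same-sign region, the component in a direction of the closed first quadrant dominates
the smaller coordinate. -/
theorem min_sq_le_sq_component {x y φ : ℝ} (hxy : 0 ≤ x * y) (hφ : φ ∈ Set.Icc 0 (π / 2)) :
    min (x ^ 2) (y ^ 2) ≤ (x * cos φ + y * sin φ) ^ 2 := by
  have hc : 0 ≤ cos φ := cos_nonneg_of_mem_Icc ⟨by linarith [hφ.1, pi_pos], hφ.2⟩
  have hs : 0 ≤ sin φ := sin_nonneg_of_mem_Icc ⟨hφ.1, by linarith [hφ.2, pi_pos]⟩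
  have hcs : 0 ≤ x * y * (cos φ * sin φ) := mul_nonneg hxy (mul_nonneg hc hs)
  have hx := mul_le_mul_of_nonneg_right (min_le_left (x ^ 2) (y ^ 2)) (sq_nonneg (cos φ))
  have hy := mul_le_mul_of_nonneg_right (min_le_right (x ^ 2) (y ^ 2)) (sq_nonneg (sin φ))
  have hm : min (x ^ 2) (y ^ 2) = min (x ^ 2) (y ^ 2) * cos φ ^ 2
      + min (x ^ 2) (y ^ 2) * sin φ ^ 2 := by
    rw [← mul_add, cos_sq_add_sin_sq, mul_one]
  nlinarith

/-- If `w` dominates the smaller of `x ^ 2` and `y ^ 2`, then the stationary phase integrand is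
dominated by a sum of two Cauchy profiles in `y`. -/
theorem inv_one_add_le_sum_cauchy {a c d x y w ρ : ℝ} (ha : 0 ≤ a) (hρ : 0 ≤ ρ)
    (hx : ρ ≤ |x|) (hw : min (x ^ 2) (y ^ 2) ≤ w) (hc : c ^ 4 ≤ a) (hd : d ^ 2 ≤ a * ρ ^ 2) :
    (1 + a * y ^ 2 * w)⁻¹ ≤ 2 * (1 + (c * y) ^ 2)⁻¹ + (1 + (d * y) ^ 2)⁻¹ := by
  have hay : 0 ≤ a * y ^ 2 := by positivity
  rcases le_total (x ^ 2) (y ^ 2) with h | h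
  · rw [min_eq_left h] at hw
    have hρx : ρ ^ 2 ≤ w := by
      have := pow_le_pow_left₀ hρ hx 2
      rw [sq_abs] at this
      exact this.trans hw
    have h1 : (d * y) ^ 2 ≤ a * y ^ 2 * w := by
      calc (d * y) ^ 2 = d ^ 2 * y ^ 2 := by ring
        _ ≤ a * ρ ^ 2 * y ^ 2 := by gcongr
        _ = a * y ^ 2 * ρ ^ 2 := by ring
        _ ≤ a * y ^ 2 * w := by gcongr
    have h2 : (1 + a * y ^ 2 * w)⁻¹ ≤ (1 + (d * y) ^ 2)⁻¹ := by gcongr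
    have h3 : 0 ≤ 2 * (1 + (c * y) ^ 2)⁻¹ := by positivity
    linarith
  · rw [min_eq_right h] at hw
    have h1 : (c * y) ^ 4 ≤ a * y ^ 2 * w := by
      calc (c * y) ^ 4 = c ^ 4 * y ^ 2 * y ^ 2 := by ring
        _ ≤ a * y ^ 2 * w := by gcongr
    have h2 : (1 + a * y ^ 2 * w)⁻¹ ≤ 2 * (1 + (c * y) ^ 2)⁻¹ := by
      have hw0 : 0 ≤ a * y ^ 2 * w := (by positivity : 0 ≤ (c * y) ^ 4).trans h1
      rw [← div_eq_mul_inv, inv_eq_one_div, div_le_div_iff₀ (by positivity) (by positivity)]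
      nlinarith [sq_nonneg ((c * y) ^ 2 - 1)]
    have h3 : 0 ≤ (1 + (d * y) ^ 2)⁻¹ := by positivity
    linarith

theorem integral_indicator_Icc_neg {L : ℝ} (hL : 0 ≤ L) :
    ∫ x, (Set.Icc (-L) L).indicator (fun _ => (1 : ℝ)) x = 2 * L := by
  rw [integral_indicator measurableSet_Icc, setIntegral_const,
    Real.volume_real_Icc_of_le (by linarith)]
  simp only [smul_eq_mul]
  ring

theorem stationary_phase_integral_same_sign_region :
    ∃ C > 0, ∀ r R μ φ : ℝ, 0 < r → r < R → 0 < μ → φ ∈ Set.Icc 0 (π / 2) →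
      (∫ ξ in {ξ : E2 | r / 2 ≤ |ξ 0| ∧ ‖ξ‖ ≤ 2 * R ∧ 0 ≤ ξ 0 * ξ 1},
          (1 + μ * (ξ 1) ^ 2 * (ξ 0 * Real.cos φ + ξ 1 * Real.sin φ) ^ 2 / (8 * R ^ 3))⁻¹)
        ≤ C * min (R ^ 2)
            (max (R ^ ((5:ℝ)/2) * r⁻¹ * μ ^ (-(1/2 : ℝ))) (R ^ ((7:ℝ)/4) * μ ^ (-(1/4 : ℝ)))) := by
  refine ⟨40 * π, by positivity, fun r R μ φ hr hrR hμ hφ => ?_⟩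
  have hR : 0 < R := hr.trans hrR
  set S : Set E2 := {ξ : E2 | r / 2 ≤ |ξ 0| ∧ ‖ξ‖ ≤ 2 * R ∧ 0 ≤ ξ 0 * ξ 1}
  have hS : MeasurableSet S := by
    refine IsClosed.measurableSet ?_
    have h1 : IsClosed {ξ : E2 | r / 2 ≤ |ξ 0|} := isClosed_le (by fun_prop) (by fun_prop)
    have h2 : IsClosed {ξ : E2 | ‖ξ‖ ≤ 2 * R} := isClosed_le (by fun_prop) (by fun_prop)
    have h3 : IsClosed {ξ : E2 | 0 ≤ ξ 0 * ξ 1} := isClosed_le (by fun_prop) (by fun_prop)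
    exact h1.inter (h2.inter h3)
  set u : ℝ → ℝ := (Set.Icc (-(2 * R)) (2 * R)).indicator fun _ => (1 : ℝ) with hu_def
  have hu0 : ∀ x, 0 ≤ u x := fun x => Set.indicator_nonneg (fun _ _ => zero_le_one) x
  have hui : Integrable u := (integrable_indicator_iff measurableSet_Icc).2 (by simp)
  have huI : ∫ x, u x = 4 * R := by
    rw [hu_def, integral_indicator_Icc_neg (by positivity)]
    ring
  have hu1 : ∀ ξ ∈ S, ∀ i, u (ξ i) = 1 := fun ξ hξ i =>
    Set.indicator_of_mem (Set.mem_Icc.2 <| abs_le.1 <| (PiLp.norm_apply_le ξ i).trans hξ.2.1) _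
  have hf0 : ∀ ξ : E2, 0 ≤
      (1 + μ * (ξ 1) ^ 2 * (ξ 0 * cos φ + ξ 1 * sin φ) ^ 2 / (8 * R ^ 3))⁻¹ :=
    fun ξ => by positivity
  rw [mul_min_of_nonneg _ _ (by positivity)]
  refine le_min ?_ ?_
  · refine (setIntegral_le_integral_mul_integral hS hf0 hu0 hu0 hui hui fun ξ hξ => ?_).trans ?_
    · rw [hu1 ξ hξ, hu1 ξ hξ, mul_one]
      exact inv_le_one_of_one_le₀ (le_add_of_nonneg_right (by positivity))
    · rw [huI]
      nlinarith [pi_gt_three, sq_nonneg R]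
  · obtain ⟨q, hq, rfl⟩ : ∃ q : ℝ, 0 < q ∧ q ^ 4 = R :=
      ⟨R ^ (1 / 4 : ℝ), by positivity, by rw [← rpow_natCast, ← rpow_mul hR.le]; norm_num⟩
    obtain ⟨m, hm, rfl⟩ : ∃ m : ℝ, 0 < m ∧ m ^ 4 = μ :=
      ⟨μ ^ (1 / 4 : ℝ), by positivity, by rw [← rpow_natCast, ← rpow_mul hμ.le]; norm_num⟩
    have hpow : ∀ {t : ℝ}, 0 < t → ∀ s : ℝ, (t ^ 4) ^ s = t ^ (4 * s) := fun ht s => by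
      rw [← rpow_natCast, ← rpow_mul ht.le]; norm_num
    have e1 : (q ^ 4) ^ ((5 : ℝ) / 2) = q ^ 10 := by
      rw [hpow hq, ← rpow_natCast]; norm_num
    have e2 : (q ^ 4) ^ ((7 : ℝ) / 4) = q ^ 7 := by
      rw [hpow hq, ← rpow_natCast]; norm_num
    have e3 : (m ^ 4) ^ (-(1 / 2 : ℝ)) = (m ^ 2)⁻¹ := by
      rw [hpow hm, ← rpow_natCast, ← rpow_neg hm.le]; norm_num
    have e4 : (m ^ 4) ^ (-(1 / 4 : ℝ)) = m⁻¹ := by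
      rw [hpow hm, ← rpow_neg_one]; norm_num
    rw [e1, e2, e3, e4]
    set c : ℝ := m / (2 * q ^ 3) with hc_def
    set d : ℝ := r * m ^ 2 / (6 * q ^ 6) with hd_def
    have hc : 0 < c := by positivity
    have hd : 0 < d := by positivity
    have hci := (integrable_inv_one_add_mul_sq hc).const_mul 2
    have hdi := integrable_inv_one_add_mul_sq hd
    have hv0 : ∀ y, 0 ≤ 2 * (1 + (c * y) ^ 2)⁻¹ + (1 + (d * y) ^ 2)⁻¹ := fun y => by positivity
    refine (setIntegral_le_integral_mul_integral hS hf0 hu0 hv0 hui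
      (hci.add hdi) fun ξ hξ => ?_).trans ?_
    · rw [hu1 ξ hξ, one_mul]
      have h := inv_one_add_le_sum_cauchy (a := m ^ 4 / (8 * (q ^ 4) ^ 3)) (c := c) (d := d)
        (by positivity) (by positivity) hξ.1 (min_sq_le_sq_component hξ.2.2 hφ) ?_ ?_
      · refine le_trans (le_of_eq ?_) h
        congr 2
        ring
      · rw [hc_def, div_pow, div_le_div_iff₀ (by positivity) (by positivity)]
        have : 0 ≤ m ^ 4 * q ^ 12 := by positivity
        nlinarith
      · rw [hd_def, div_pow, div_mul_eq_mul_div, div_le_div_iff₀ (by positivity) (by positivity)]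
        have : 0 ≤ r ^ 2 * m ^ 4 * q ^ 12 := by positivity
        nlinarith
    · have hI : ∫ y, (2 * (1 + (c * y) ^ 2)⁻¹ + (1 + (d * y) ^ 2)⁻¹)
          = 2 * (π / c) + π / d := by
        rw [integral_add hci hdi, integral_const_mul, integral_inv_one_add_mul_sq hc,
          integral_inv_one_add_mul_sq hd]
      have hsum : 4 * q ^ 4 * (2 * (π / c) + π / d)
          = 24 * π * (q ^ 10 * r⁻¹ * (m ^ 2)⁻¹) + 16 * π * (q ^ 7 * m⁻¹) := by
        rw [hc_def, hd_def]
        field_simp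
        ring
      rw [huI, hI, hsum]
      have h1 := mul_le_mul_of_nonneg_left
        (le_max_left (q ^ 10 * r⁻¹ * (m ^ 2)⁻¹) (q ^ 7 * m⁻¹)) (by positivity : 0 ≤ 24 * π)
      have h2 := mul_le_mul_of_nonneg_left
        (le_max_right (q ^ 10 * r⁻¹ * (m ^ 2)⁻¹) (q ^ 7 * m⁻¹)) (by positivity : 0 ≤ 16 * π)
      linarith

end
end

section
/- There exists an absolute constant C > 0 such that for all 0 < r < R, all μ > 0, and all φ ∈ (0, arctan(r/(8R))], H̃(μ, φ) ≤ C R^{5/2} r^{−1} μ^{−1/2}. (For such φ one has (r/2) cos φ − 2R sin φ ≥ (r/4) cos φ, so ξ₁ cos φ − ξ₂ sin φ ≥ (r/4) cos φ on the domain of integration.) -/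
/- STATEMENT 5:
There is an absolute constant C > 0 such that for all 0 < r < R, μ > 0, and
φ ∈ (0, arctan(r/(8R))], H̃(μ,φ) ≤ C R^{5/2} r^{−1} μ^{−1/2}. -/

open Real

/-- The quantity
`H̃(μ,φ) = ∫₀^{2R} ∫_{r/2}^{2R} (1 + μ ξ₂² (ξ₁ cos φ − ξ₂ sin φ)² / (8R³))⁻¹ dξ₁ dξ₂`. -/
noncomputable def Htilde (r R μ φ : ℝ) : ℝ :=
  ∫ ξ₂ in (0:ℝ)..(2 * R), ∫ ξ₁ in (r / 2)..(2 * R),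
    (1 + μ * ξ₂ ^ 2 * (ξ₁ * Real.cos φ - ξ₂ * Real.sin φ) ^ 2 / (8 * R ^ 3))⁻¹

/-- For `0 ≤ φ ≤ arctan (r / (8R))` the linear form `ξ₁ cos φ - ξ₂ sin φ` is bounded away from zero
on `[r/2, ∞) × (-∞, 2R]`. -/
lemma sq_div_le_sq_linear_form {r R φ x y : ℝ} (hr : 0 < r) (hrR : r < R) (hφ : 0 ≤ φ)
    (hφ' : φ ≤ arctan (r / (8 * R))) (hx : r / 2 ≤ x) (hy : y ≤ 2 * R) :
    r ^ 2 / 32 ≤ (x * cos φ - y * sin φ) ^ 2 := by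
  have hR : 0 < R := hr.trans hrR
  have hlt : φ < π / 2 := hφ'.trans_lt (arctan_lt_pi_div_two _)
  have hcos : 0 < cos φ := cos_pos_of_mem_Ioo ⟨by linarith [pi_pos], hlt⟩
  have hsin : 0 ≤ sin φ := sin_nonneg_of_nonneg_of_le_pi hφ (by linarith [pi_pos])
  have htan : sin φ * (8 * R) ≤ r * cos φ := by
    have h : φ ≤ arctan (r / (8 * R)) := hφ'
    rw [← arctan_tan (by linarith [pi_pos]) hlt, arctan_le_arctan_iff, tan_eq_sin_div_cos,
      div_le_div_iff₀ hcos (by positivity)] at h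
    exact h
  have hle : sin φ ≤ cos φ := by nlinarith
  have hform : r / 4 * cos φ ≤ x * cos φ - y * sin φ := by
    nlinarith [mul_le_mul_of_nonneg_right hx hcos.le, mul_le_mul_of_nonneg_right hy hsin]
  have hcos2 : 1 / 2 ≤ cos φ ^ 2 := by nlinarith [sin_sq_add_cos_sq φ]
  calc r ^ 2 / 32 = (r / 4) ^ 2 * (1 / 2) := by ring
    _ ≤ (r / 4) ^ 2 * cos φ ^ 2 := by gcongr
    _ = (r / 4 * cos φ) ^ 2 := by ring
    _ ≤ _ := by gcongr

lemma integral_inv_one_add_mul_sq_le {s : ℝ} (hs : 0 < s) (b : ℝ) :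
    ∫ y in (0:ℝ)..b, (1 + (s * y) ^ 2)⁻¹ ≤ s⁻¹ * (π / 2) := by
  rw [intervalIntegral.integral_comp_mul_left (fun y => (1 + y ^ 2)⁻¹) hs.ne',
    integral_inv_one_add_sq, smul_eq_mul]
  gcongr
  simpa using (arctan_lt_pi_div_two (s * b)).le

theorem Htilde_phi_near_zero_bound :
    ∃ C > 0, ∀ r R μ φ : ℝ, 0 < r → r < R → 0 < μ →
      φ ∈ Set.Ioc 0 (Real.arctan (r / (8 * R))) →
      Htilde r R μ φ ≤ C * R ^ ((5:ℝ)/2) * r⁻¹ * μ ^ (-(1/2 : ℝ)) := by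
  refine ⟨16 * π, by positivity, fun r R μ φ hr hrR hμ ⟨hφ, hφ'⟩ => ?_⟩
  have hR : 0 < R := hr.trans hrR
  set s : ℝ := r * √μ / (16 * (R * √R)) with hs_def
  have hs : 0 < s := by positivity
  have hs2 : s ^ 2 = μ * (r ^ 2 / 32) / (8 * R ^ 3) := by
    rw [hs_def, div_pow, mul_pow, mul_pow, mul_pow, sq_sqrt hμ.le, sq_sqrt hR.le]
    field_simp
    norm_num
  have hcont : Continuous (Function.uncurry fun y x : ℝ =>
      (1 + μ * y ^ 2 * (x * cos φ - y * sin φ) ^ 2 / (8 * R ^ 3))⁻¹) := by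
    refine Continuous.inv₀ (by fun_prop) fun p => ?_
    positivity
  have hcont' : Continuous fun y : ℝ => (1 + (s * y) ^ 2)⁻¹ :=
    Continuous.inv₀ (by fun_prop) fun y => by positivity
  have hpoint : ∀ y ∈ Set.Icc 0 (2 * R), ∀ x ∈ Set.Icc (r / 2) (2 * R),
      (1 + μ * y ^ 2 * (x * cos φ - y * sin φ) ^ 2 / (8 * R ^ 3))⁻¹ ≤ (1 + (s * y) ^ 2)⁻¹ := by
    intro y hy x hx
    have hform := sq_div_le_sq_linear_form hr hrR hφ.le hφ' hx.1 hy.2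
    have hsy : (s * y) ^ 2 = μ * y ^ 2 * (r ^ 2 / 32) / (8 * R ^ 3) := by
      rw [mul_pow, hs2]
      ring
    rw [hsy]
    gcongr
  have hinner : ∀ y ∈ Set.Icc 0 (2 * R), ∫ x in (r / 2)..(2 * R),
      (1 + μ * y ^ 2 * (x * cos φ - y * sin φ) ^ 2 / (8 * R ^ 3))⁻¹
        ≤ 2 * R * (1 + (s * y) ^ 2)⁻¹ := by
    intro y hy
    calc _ ≤ ∫ _ in (r / 2)..(2 * R), (1 + (s * y) ^ 2)⁻¹ :=
          intervalIntegral.integral_mono_on (by linarith)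
            ((hcont.comp (Continuous.prodMk_right y)).intervalIntegrable _ _)
            intervalIntegrable_const (hpoint y hy)
      _ = (2 * R - r / 2) * (1 + (s * y) ^ 2)⁻¹ := by simp
      _ ≤ _ := by
          gcongr
          linarith
  have hpow : R ^ ((5:ℝ) / 2) = R ^ 2 * √R := by
    rw [sqrt_eq_rpow, ← rpow_natCast R 2, ← rpow_add hR]
    norm_num
  have hpow' : μ ^ (-(1 / 2 : ℝ)) = (√μ)⁻¹ := by
    rw [rpow_neg hμ.le, sqrt_eq_rpow]
  calc Htilde r R μ φ ≤ ∫ y in (0:ℝ)..(2 * R), 2 * R * (1 + (s * y) ^ 2)⁻¹ :=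
        intervalIntegral.integral_mono_on (by linarith)
          ((intervalIntegral.continuous_parametric_intervalIntegral_of_continuous'
            hcont _ _).intervalIntegrable _ _)
          ((continuous_const.mul hcont').intervalIntegrable _ _) hinner
    _ = 2 * R * ∫ y in (0:ℝ)..(2 * R), (1 + (s * y) ^ 2)⁻¹ :=
        intervalIntegral.integral_const_mul _ _
    _ ≤ 2 * R * (s⁻¹ * (π / 2)) := by
        gcongr
        exact integral_inv_one_add_mul_sq_le hs _
    _ = _ := by
        rw [hpow, hpow', hs_def]
        field_simp
end
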